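/- Let n ≥ 0 and suppose -U^n = G_1⋯G_r where each G_i is a conjugate of U in SL(2,ℤ). Then there exists an integer s ≥ 0 with r = n + 6 + 12s, and a finite sequence of Hurwitz moves transforms the sequence (G_1,…,G_r) into the sequence consisting of n copies of U followed by 6s+3 copies of the pair (V, U), i.e. into the factorization U^n(VU)^{6s+3}. -/

import Mathlib

/-- `SL(2,ℤ)`, the group of 2×2 integer matrices of determinant 1. -/
abbrev SL2Z := Matrix.SpecialLinearGroup (Fin 2) ℤ

instance : Fact (Even (Fintype.card (Fin 2))) := ⟨by simp⟩

/-- The matrix `U = [[1,1],[0,1]]`. -/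
def U : SL2Z := ⟨!![1, 1; 0, 1], by norm_num [Matrix.det_fin_two_of]⟩

/-- The matrix `V = [[1,0],[-1,1]]`. -/
def V : SL2Z := ⟨!![1, 0; -1, 1], by norm_num [Matrix.det_fin_two_of]⟩

/-- A single Hurwitz move on a finite sequence of elements of a group: some consecutive
pair `(a, b)` is replaced by `(b, b⁻¹ * a * b)` or by `(a * b * a⁻¹, a)`. -/
def HurwitzMove {G : Type*} [Group G] (L L' : List G) : Prop :=
  ∃ (p : List G) (a b : G) (t : List G),
    L = p ++ a :: b :: t ∧
    (L' = p ++ b :: (b⁻¹ * a * b) :: t ∨ L' = p ++ (a * b * a⁻¹) :: a :: t)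

/-- A finite sequence of Hurwitz moves. -/
def HurwitzEquiv {G : Type*} [Group G] : List G → List G → Prop :=
  Relation.ReflTransGen HurwitzMove

namespace HurwitzEquiv

variable {G : Type*} [Group G]

lemma refl (l : List G) : HurwitzEquiv l l := Relation.ReflTransGen.refl

lemma trans {l₁ l₂ l₃ : List G} (h : HurwitzEquiv l₁ l₂) (h' : HurwitzEquiv l₂ l₃) :
    HurwitzEquiv l₁ l₃ := Relation.ReflTransGen.trans h h'

lemma append {l l' : List G} (h : HurwitzEquiv l l') (p q : List G) :
    HurwitzEquiv (p ++ l ++ q) (p ++ l' ++ q) := by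
  induction h with
  | refl => exact refl _
  | tail _ hstep ih =>
    refine ih.trans (Relation.ReflTransGen.single ?_)
    obtain ⟨p', a, b, t, rfl, rfl | rfl⟩ := hstep
    · exact ⟨p ++ p', a, b, t ++ q, by simp, Or.inl (by simp)⟩
    · exact ⟨p ++ p', a, b, t ++ q, by simp, Or.inr (by simp)⟩

lemma append_left {l l' : List G} (h : HurwitzEquiv l l') (p : List G) :
    HurwitzEquiv (p ++ l) (p ++ l') := by
  simpa using h.append p []

lemma append_right {l l' : List G} (h : HurwitzEquiv l l') (q : List G) :
    HurwitzEquiv (l ++ q) (l' ++ q) := by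
  simpa using h.append [] q

lemma swap_right (a b : G) : HurwitzEquiv [a, b] [b, b⁻¹ * a * b] :=
  Relation.ReflTransGen.single ⟨[], a, b, [], rfl, Or.inl rfl⟩

lemma swap_left (a b : G) : HurwitzEquiv [a, b] [a * b * a⁻¹, a] :=
  Relation.ReflTransGen.single ⟨[], a, b, [], rfl, Or.inr rfl⟩

lemma prod_eq {l l' : List G} (h : HurwitzEquiv l l') : l.prod = l'.prod := by
  induction h with
  | refl => rfl
  | tail _ hstep ih =>
    rw [ih]
    obtain ⟨p', a, b, t, rfl, rfl | rfl⟩ := hstep <;> simp [mul_assoc]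

lemma length_eq {l l' : List G} (h : HurwitzEquiv l l') : l.length = l'.length := by
  induction h with
  | refl => rfl
  | tail _ hstep ih =>
    rw [ih]
    obtain ⟨p', a, b, t, rfl, rfl | rfl⟩ := hstep <;> simp

/-- An element can be moved to the right past a list, being conjugated by its product. -/
lemma cons_to_right (x : G) (l : List G) :
    HurwitzEquiv (x :: l) (l ++ [l.prod⁻¹ * x * l.prod]) := by
  induction l generalizing x with
  | nil => simpa using refl [x]
  | cons y l ih =>
    have h := ((swap_right x y).append_right l).trans ((ih (y⁻¹ * x * y)).append_left [y])
    simpa [mul_assoc] using h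

/-- A list can be moved to the left past another one, which is conjugated by its product. -/
lemma append_comm_conj (p l : List G) :
    HurwitzEquiv (p ++ l) (l ++ p.map fun x => l.prod⁻¹ * x * l.prod) := by
  induction p with
  | nil => simpa using refl l
  | cons x p ih =>
    have h := (ih.append_left [x]).trans
      ((cons_to_right x l).append_right (p.map fun x => l.prod⁻¹ * x * l.prod))
    simpa using h

/-- An element can be moved to the left past a list, being conjugated by its product. -/
lemma append_singleton_to_left (l : List G) (x : G) :
    HurwitzEquiv (l ++ [x]) ((l.prod * x * l.prod⁻¹) :: l) := by
  induction l with
  | nil => simpa using refl [x]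
  | cons y l ih =>
    have h := (ih.append_left [y]).trans
      ((swap_left y (l.prod * x * l.prod⁻¹)).append_right l)
    simpa [mul_assoc] using h

/-- A list can be moved to the right past another one, which is conjugated by its product. -/
lemma append_comm_conj' (l p : List G) :
    HurwitzEquiv (l ++ p) ((p.map fun x => l.prod * x * l.prod⁻¹) ++ l) := by
  induction p with
  | nil => simpa using refl l
  | cons x p ih =>
    have h := ((append_singleton_to_left l x).append_right p).trans
      (ih.append_left [l.prod * x * l.prod⁻¹])
    simpa using h

end HurwitzEquiv

namespace SL2Z

/-- The entries of a product. -/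
lemma mul_apply' (M N : SL2Z) (i j : Fin 2) :
    (M * N) i j = M i 0 * N 0 j + M i 1 * N 1 j := by
  simp [Matrix.mul_apply, Fin.sum_univ_two]

lemma inv_apply (M : SL2Z) :
    M⁻¹ 0 0 = M 1 1 ∧ M⁻¹ 0 1 = -M 0 1 ∧ M⁻¹ 1 0 = -M 1 0 ∧ M⁻¹ 1 1 = M 0 0 := by
  rw [Matrix.SpecialLinearGroup.SL2_inv_expl]
  simp

lemma det_eq (M : SL2Z) : M 0 0 * M 1 1 - M 0 1 * M 1 0 = 1 := by
  have := M.det_coe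
  rwa [Matrix.det_fin_two] at this

lemma ext_iff' (M N : SL2Z) :
    M = N ↔ M 0 0 = N 0 0 ∧ M 0 1 = N 0 1 ∧ M 1 0 = N 1 0 ∧ M 1 1 = N 1 1 := by
  rw [Matrix.SpecialLinearGroup.ext_iff]
  simp [Fin.forall_fin_two, and_assoc]

/-- The lower triangular matrix `[[1,0],[1,1]]`. -/
def Low : SL2Z := ⟨!![1, 0; 1, 1], by norm_num [Matrix.det_fin_two_of]⟩

/-- The element `[[0,1],[-1,0]] = UVU` of order 4. -/
def ω : SL2Z := ⟨!![0, 1; -1, 0], by norm_num [Matrix.det_fin_two_of]⟩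

/-- The element `[[0,-1],[1,-1]] = -UV` of order 3. -/
def b : SL2Z := ⟨!![0, -1; 1, -1], by norm_num [Matrix.det_fin_two_of]⟩

/-- The conjugate `UVU⁻¹ = V⁻¹UV` of `U`. -/
def C : SL2Z := ⟨!![0, 1; -1, 2], by norm_num [Matrix.det_fin_two_of]⟩

lemma U_apply : U 0 0 = 1 ∧ U 0 1 = 1 ∧ U 1 0 = 0 ∧ U 1 1 = 1 := ⟨rfl, rfl, rfl, rfl⟩
lemma Low_apply : Low 0 0 = 1 ∧ Low 0 1 = 0 ∧ Low 1 0 = 1 ∧ Low 1 1 = 1 := ⟨rfl, rfl, rfl, rfl⟩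
lemma ω_apply : ω 0 0 = 0 ∧ ω 0 1 = 1 ∧ ω 1 0 = -1 ∧ ω 1 1 = 0 := ⟨rfl, rfl, rfl, rfl⟩
lemma b_apply : b 0 0 = 0 ∧ b 0 1 = -1 ∧ b 1 0 = 1 ∧ b 1 1 = -1 := ⟨rfl, rfl, rfl, rfl⟩
lemma b_sq_apply : (b ^ 2) 0 0 = -1 ∧ (b ^ 2) 0 1 = 1 ∧ (b ^ 2) 1 0 = -1 ∧ (b ^ 2) 1 1 = 0 := by
  decide

lemma U_pow_apply (n : ℕ) :
    (U ^ n) 0 0 = 1 ∧ (U ^ n) 0 1 = n ∧ (U ^ n) 1 0 = 0 ∧ (U ^ n) 1 1 = 1 := by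
  induction n with
  | zero => simp
  | succ n ih =>
    obtain ⟨h1, h2, h3, h4⟩ := ih
    simp [pow_succ, mul_apply', h1, h2, h3, h4, U_apply, add_comm]

lemma b_mul_ω : b * ω = Low := by decide
lemma ω_mul_ω : ω * ω = -1 := by decide
lemma UV_eq : U * V = -b := by decide

/-- All entries have the same sign, in the weak sense. -/
def SignDef (M : SL2Z) : Prop := (∀ i j, 0 ≤ M i j) ∨ ∀ i j, M i j ≤ 0

lemma neg_apply' (M : SL2Z) (i j : Fin 2) : (-M) i j = -M i j := by
  simp

lemma signDef_iff (M : SL2Z) : SignDef M ↔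
    (0 ≤ M 0 0 ∧ 0 ≤ M 0 1 ∧ 0 ≤ M 1 0 ∧ 0 ≤ M 1 1) ∨
    (M 0 0 ≤ 0 ∧ M 0 1 ≤ 0 ∧ M 1 0 ≤ 0 ∧ M 1 1 ≤ 0) := by
  simp [SignDef, Fin.forall_fin_two, and_assoc]

lemma SignDef.neg {M : SL2Z} (h : SignDef M) : SignDef (-M) := by
  rcases h with h | h
  · exact Or.inr fun i j => by rw [neg_apply']; linarith [h i j]
  · exact Or.inl fun i j => by rw [neg_apply']; linarith [h i j]

lemma SignDef.mul {M N : SL2Z} (hM : SignDef M) (hN : SignDef N) : SignDef (M * N) := by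
  rcases hM with hM | hM <;> rcases hN with hN | hN
  · exact Or.inl fun i j => by
      rw [mul_apply']; nlinarith [mul_nonneg (hM i 0) (hN 0 j), mul_nonneg (hM i 1) (hN 1 j)]
  · exact Or.inr fun i j => by
      rw [mul_apply']
      nlinarith [mul_nonneg_of_nonpos_of_nonpos (hN 0 j) (neg_nonpos.2 (hM i 0)),
        mul_nonneg_of_nonpos_of_nonpos (hN 1 j) (neg_nonpos.2 (hM i 1))]
  · exact Or.inr fun i j => by
      rw [mul_apply']
      nlinarith [mul_nonneg_of_nonpos_of_nonpos (hM i 0) (neg_nonpos.2 (hN 0 j)),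
        mul_nonneg_of_nonpos_of_nonpos (hM i 1) (neg_nonpos.2 (hN 1 j))]
  · exact Or.inl fun i j => by
      rw [mul_apply']
      nlinarith [mul_nonneg_of_nonpos_of_nonpos (hM i 0) (hN 0 j),
        mul_nonneg_of_nonpos_of_nonpos (hM i 1) (hN 1 j)]

/-- For matrices with entries of constant sign, lower left entries of products do not cancel. -/
lemma SignDef.abs_le_mul {M N : SL2Z} (hM : SignDef M) (hN : SignDef N) :
    |M 1 0| + |N 1 0| ≤ |(M * N) 1 0| := by
  have key : ∀ {M N : SL2Z}, (∀ i j, 0 ≤ M i j) → (∀ i j, 0 ≤ N i j) →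
      |M 1 0| + |N 1 0| ≤ |(M * N) 1 0| := by
    intro M N hM hN
    have dM := det_eq M
    have dN := det_eq N
    have h1 : 1 ≤ M 1 1 := by
      by_contra h
      have : M 1 1 = 0 := le_antisymm (by linarith) (hM 1 1)
      rw [this] at dM
      nlinarith [mul_nonneg (hM 0 1) (hM 1 0)]
    have h2 : 1 ≤ N 0 0 := by
      by_contra h
      have : N 0 0 = 0 := le_antisymm (by linarith) (hN 0 0)
      rw [this] at dN
      nlinarith [mul_nonneg (hN 0 1) (hN 1 0)]
    rw [mul_apply', abs_of_nonneg (hM 1 0), abs_of_nonneg (hN 1 0),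
      abs_of_nonneg (by nlinarith [hM 1 0, hN 1 0])]
    nlinarith [hM 1 0, hN 1 0]
  rcases hM with hM | hM <;> rcases hN with hN | hN
  · exact key hM hN
  · have := key (N := -N) hM fun i j => by rw [neg_apply']; linarith [hN i j]
    simpa only [mul_neg, neg_apply', abs_neg] using this
  · have := key (M := -M) (fun i j => by rw [neg_apply']; linarith [hM i j]) hN
    simpa only [neg_mul, neg_apply', abs_neg] using this
  · have := key (M := -M) (N := -N) (fun i j => by rw [neg_apply']; linarith [hM i j])
      fun i j => by rw [neg_apply']; linarith [hN i j]
    simpa only [neg_mul, mul_neg, neg_neg, neg_apply', abs_neg] using this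

lemma signDef_U : SignDef U := by rw [signDef_iff]; decide
lemma signDef_Low : SignDef Low := by rw [signDef_iff]; decide

/-- The transpose, written inside the group. -/
def tr (M : SL2Z) : SL2Z := ω * M⁻¹ * ω⁻¹

lemma tr_apply (M : SL2Z) :
    tr M 0 0 = M 0 0 ∧ tr M 0 1 = M 1 0 ∧ tr M 1 0 = M 0 1 ∧ tr M 1 1 = M 1 1 := by
  obtain ⟨h1, h2, h3, h4⟩ := inv_apply M
  obtain ⟨k1, k2, k3, k4⟩ := inv_apply ω
  simp [tr, mul_apply', h1, h2, h3, h4, k1, k2, k3, k4, ω_apply]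

lemma SignDef.tr {M : SL2Z} (h : SignDef M) : SignDef (tr M) := by
  obtain ⟨h1, h2, h3, h4⟩ := tr_apply M
  rw [signDef_iff] at h ⊢
  rw [h1, h2, h3, h4]
  tauto

/-- The two letters of the free monoid of matrices with nonnegative entries. -/
def letter : Bool → SL2Z
  | true => U
  | false => Low

/-- The value of a word in `U` and `Low`. -/
def word (x : List Bool) : SL2Z := (x.map letter).prod

@[simp] lemma word_nil : word [] = 1 := rfl
@[simp] lemma word_cons (e : Bool) (x : List Bool) : word (e :: x) = letter e * word x := by
  simp [word]
@[simp] lemma word_append (x y : List Bool) : word (x ++ y) = word x * word y := by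
  simp [word]

lemma signDef_one : SignDef 1 := by rw [signDef_iff]; decide

lemma signDef_word (x : List Bool) : SignDef (word x) := by
  induction x with
  | nil => exact signDef_one
  | cons e x ih =>
    rw [word_cons]
    cases e
    · exact signDef_Low.mul ih
    · exact signDef_U.mul ih

/-- Words encoding the conjugates of `U`: a power of `b`, possibly followed by `ω` and a word in
`U` and `Low`. -/
inductive Rep
  | short (i : Fin 3)
  | long (i : Fin 3) (x : List Bool)

namespace Rep

/-- The matrix spelled by a representative. -/
def mat : Rep → SL2Z
  | short i => b ^ (i : ℕ)
  | long i x => b ^ (i : ℕ) * ω * word x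

/-- The conjugate of `C` (hence of `U`) encoded by a representative. -/
def elt (r : Rep) : SL2Z := r.mat * C * r.mat⁻¹

/-- The number of letters `ω` in a representative. -/
def len : Rep → ℕ
  | short _ => 0
  | long _ x => x.length + 1

/-- Left multiplication by `b`. -/
def rot : Rep → Rep
  | short i => short (i + 1)
  | long i x => long (i + 1) x

lemma len_rot (r : Rep) : r.rot.len = r.len := by cases r <;> rfl

lemma b_pow_fin_add_one (i : Fin 3) : b ^ ((i + 1 : Fin 3) : ℕ) = b * b ^ (i : ℕ) := by
  revert i; decide

lemma mat_rot (r : Rep) : r.rot.mat = b * r.mat := by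
  cases r <;> simp [rot, mat, b_pow_fin_add_one, mul_assoc]

lemma elt_rot (r : Rep) : r.rot.elt = b * r.elt * b⁻¹ := by
  simp [elt, mat_rot, mul_assoc]

lemma exists_conj_b_pow (n : ℕ) (r : Rep) :
    ∃ r' : Rep, r'.len ≤ r.len ∧ r'.elt = b ^ n * r.elt * (b ^ n)⁻¹ := by
  induction n with
  | zero => exact ⟨r, le_rfl, by simp⟩
  | succ n ih =>
    obtain ⟨r', h, h'⟩ := ih
    exact ⟨r'.rot, by rwa [len_rot], by rw [elt_rot, h', pow_succ']; group⟩

lemma elt_eq_of_mat (r : Rep) (M : SL2Z) (h : r.mat = M ∨ r.mat = -M) :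
    r.elt = M * C * M⁻¹ := by
  rcases h with h | h <;> simp [elt, h, inv_neg]

lemma exists_conj_ω (r : Rep) :
    ∃ r' : Rep, r'.len ≤ r.len + 1 ∧ r'.elt = ω * r.elt * ω⁻¹ := by
  have key : ∀ r' : Rep, (r'.mat = ω * r.mat ∨ r'.mat = -(ω * r.mat)) →
      r'.elt = ω * r.elt * ω⁻¹ := by
    intro r' h
    rw [elt_eq_of_mat r' _ h, elt]
    group
  have three : ∀ i : Fin 3, i = 0 ∨ i = 1 ∨ i = 2 := by decide
  have hU : b ^ ((2 : Fin 3) : ℕ) * ω = -U := by decide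
  rcases r with i | ⟨i, x⟩
  · rcases three i with rfl | rfl | rfl
    · exact ⟨long 0 [], by simp [len], key _ (Or.inl (by simp [mat]))⟩
    · exact ⟨short 2, by simp [len], by decide⟩
    · exact ⟨short 1, by simp [len], by decide⟩
  · rcases three i with rfl | rfl | rfl
    · have hC : ω * (long 0 x).elt * ω⁻¹ = word x * C * (word x)⁻¹ := by
        have : ω * (long 0 x).mat = - word x := by
          rw [mat, Fin.val_zero, pow_zero, one_mul, ← mul_assoc, ω_mul_ω, neg_one_mul]
        calc _ = (ω * (long 0 x).mat) * C * (ω * (long 0 x).mat)⁻¹ := by rw [elt]; group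
          _ = _ := by rw [this]; simp [inv_neg]
      rw [hC]
      rcases x with _ | ⟨_ | _, x⟩
      · exact ⟨short 0, by simp [len], by simp [elt, mat]⟩
      · refine ⟨long 1 x, by simp [len], elt_eq_of_mat _ _ (Or.inl ?_)⟩
        simp [mat, letter, b_mul_ω]
      · refine ⟨long 2 x, by simp [len], elt_eq_of_mat _ _ (Or.inr ?_)⟩
        rw [mat, hU]
        simp [letter]
    · refine ⟨long 0 (false :: x), by simp [len], key _ (Or.inl ?_)⟩
      simp [mat, letter, ← b_mul_ω, mul_assoc]
    · refine ⟨long 0 (true :: x), by simp [len], key _ (Or.inr ?_)⟩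
      rw [mat, mat, hU]
      simp [letter]

lemma exists_conj_word (x : List Bool) (r : Rep) :
    ∃ r' : Rep, r'.len ≤ r.len + x.length ∧ r'.elt = word x * r.elt * (word x)⁻¹ := by
  induction x with
  | nil => exact ⟨r, le_rfl, by simp⟩
  | cons e x ih =>
    obtain ⟨r₁, h₁, h₁'⟩ := ih
    obtain ⟨r₂, h₂, h₂'⟩ := exists_conj_ω r₁
    cases e
    · refine ⟨r₂.rot, by simp [len_rot]; omega, ?_⟩
      rw [elt_rot, h₂', h₁', word_cons, letter, ← b_mul_ω]
      group
    · obtain ⟨r₃, h₃, h₃'⟩ := exists_conj_b_pow 2 r₂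
      refine ⟨r₃, by simp; omega, ?_⟩
      have : U = -(b ^ 2 * ω) := by decide
      rw [h₃', h₂', h₁', word_cons, letter, this]
      simp [inv_neg, mul_assoc]

/-- Every conjugate of `U` is encoded by a representative. -/
lemma exists_of_isConj {A : SL2Z} (h : IsConj U A) : ∃ r : Rep, r.elt = A := by
  have key : ∀ g : SL2Z, (∀ r : Rep, ∃ r' : Rep, r'.elt = g * r.elt * g⁻¹) ∧
      ∀ r : Rep, ∃ r' : Rep, r'.elt = g⁻¹ * r.elt * g := by
    have hb : ∀ (n : ℕ) (r : Rep), ∃ r' : Rep, r'.elt = b ^ n * r.elt * (b ^ n)⁻¹ := fun n r =>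
      (exists_conj_b_pow n r).imp fun _ h => h.2
    have hω : ∀ r : Rep, ∃ r' : Rep, r'.elt = ω * r.elt * ω⁻¹ := fun r =>
      (exists_conj_ω r).imp fun _ h => h.2
    intro g
    have hg : g ∈ Subgroup.closure ({ModularGroup.S, ModularGroup.T} : Set SL2Z) := by
      rw [_root_.SpecialLinearGroup.SL2Z_generators]; trivial
    induction hg using Subgroup.closure_induction with
    | mem x hx =>
      rcases hx with rfl | rfl
      · have h₁ : ModularGroup.S = -ω := by decide
        have h₂ : ModularGroup.S⁻¹ = ω := by decide
        refine ⟨fun r => by simpa [h₁, inv_neg] using hω r, fun r => ?_⟩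
        have h₃ : ModularGroup.S = ω⁻¹ := by decide
        rw [h₂, h₃]
        exact hω r
      · have h₁ : ModularGroup.T = -(b ^ 2 * ω) := by decide
        have h₂ : ModularGroup.T⁻¹ = ω * b := by decide
        refine ⟨fun r => ?_, fun r => ?_⟩
        · obtain ⟨r₁, hr₁⟩ := hω r
          obtain ⟨r₂, hr₂⟩ := hb 2 r₁
          exact ⟨r₂, by rw [hr₂, hr₁, h₁]; simp [inv_neg, mul_assoc]⟩
        · obtain ⟨r₁, hr₁⟩ := hb 1 r
          obtain ⟨r₂, hr₂⟩ := hω r₁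
          refine ⟨r₂, ?_⟩
          rw [hr₂, hr₁, ← inv_inv ModularGroup.T, h₂]
          group
    | inv x _ hx => exact ⟨by simpa using hx.2, by simpa using hx.1⟩
    | one => exact ⟨fun r => ⟨r, by simp⟩, fun r => ⟨r, by simp⟩⟩
    | mul x y _ _ hx hy =>
      refine ⟨fun r => ?_, fun r => ?_⟩
      · obtain ⟨r₁, h₁⟩ := hy.1 r
        obtain ⟨r₂, h₂⟩ := hx.1 r₁
        exact ⟨r₂, by rw [h₂, h₁]; group⟩
      · obtain ⟨r₁, h₁⟩ := hx.2 r
        obtain ⟨r₂, h₂⟩ := hy.2 r₁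
        exact ⟨r₂, by rw [h₂, h₁]; group⟩
  obtain ⟨c, rfl⟩ := isConj_iff.1 h
  obtain ⟨r, hr⟩ := (key c).1 (short 1)
  have : (short 1).elt = U := by decide
  exact ⟨r, by rw [hr, this]⟩

/-- The part of the product of two encoded elements lying between their central letters `ω`. -/
def junction (r r' : Rep) : SL2Z := b * r.mat⁻¹ * r'.mat * b * ω

/-- A pair is reduced if the letters `ω` at its centres survive in the product. -/
def Reduced (r r' : Rep) : Prop :=
  SignDef (junction r r') ∧ (junction r r' 1 0 = 0 → r'.elt = r.elt)

lemma b_mul_inv_mat_long (i : Fin 3) (x : List Bool) :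
    b * (long i x).mat⁻¹ = -(Low * tr (word x)) * (b ^ (i : ℕ))⁻¹ := by
  have h : -(b * (ω * ω)) = b := by rw [ω_mul_ω]; simp
  rw [← b_mul_ω, tr, mat]
  calc _ = -(b * (ω * ω)) * (b ^ (i : ℕ) * ω * word x)⁻¹ := by rw [h]
    _ = _ := by simp [mul_assoc]

lemma mat_long_mul (i : Fin 3) (x : List Bool) :
    (long i x).mat * b * ω = b ^ (i : ℕ) * ω * word x * Low := by
  rw [mat, mul_assoc _ b, b_mul_ω]

lemma b_pow_inv_mul (i d : Fin 3) : (b ^ (i : ℕ))⁻¹ * b ^ ((i + d : Fin 3) : ℕ) = b ^ (d : ℕ) := by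
  revert i d; decide

lemma eq_add (i j : Fin 3) : j = i + 0 ∨ j = i + 1 ∨ j = i + 2 := by
  revert i j; decide

lemma reduced_of_signDef {r r' : Rep} (h : SignDef (junction r r'))
    (h' : 1 ≤ |junction r r' 1 0|) : Reduced r r' :=
  ⟨h, fun h0 => by rw [h0] at h'; norm_num at h'⟩

lemma one_le_abs_low_mul {M : SL2Z} (hM : SignDef M) : 1 ≤ |(Low * M) 1 0| := by
  have h := signDef_Low.abs_le_mul hM
  have h0 := abs_nonneg (M 1 0)
  rw [Low_apply.2.2.1, abs_one] at h
  linarith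

lemma one_le_abs_mul_low {M : SL2Z} (hM : SignDef M) : 1 ≤ |(M * Low) 1 0| := by
  have h := hM.abs_le_mul signDef_Low
  have h0 := abs_nonneg (M 1 0)
  rw [Low_apply.2.2.1, abs_one] at h
  linarith

lemma reduced_of_eq_low_mul {r r' : Rep} {M : SL2Z} (hM : SignDef M)
    (h : junction r r' = Low * M ∨ junction r r' = -(Low * M)) : Reduced r r' := by
  have := one_le_abs_low_mul hM
  rcases h with h | h
  · exact reduced_of_signDef (h ▸ signDef_Low.mul hM) (h ▸ this)
  · exact reduced_of_signDef (h ▸ (signDef_Low.mul hM).neg) (by rwa [h, neg_apply', abs_neg])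

lemma reduced_of_eq_mul_low {r r' : Rep} {M : SL2Z} (hM : SignDef M)
    (h : junction r r' = M * Low ∨ junction r r' = -(M * Low)) : Reduced r r' := by
  have := one_le_abs_mul_low hM
  rcases h with h | h
  · exact reduced_of_signDef (h ▸ hM.mul signDef_Low) (h ▸ this)
  · exact reduced_of_signDef (h ▸ (hM.mul signDef_Low).neg) (by rwa [h, neg_apply', abs_neg])

/-- Two words are equal, one extends the other in the direction that allows a shortening, or the
junction of the conjugates they define is reduced. -/
lemma compare_words (x y : List Bool) :
    x = y ∨ (∃ z, y = x ++ true :: z) ∨ (∃ z, x = y ++ false :: z) ∨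
      ∃ M : SL2Z, SignDef M ∧
        (b * (word x)⁻¹ * word y * Low = Low * M ∨ b * (word x)⁻¹ * word y * Low = M * Low) := by
  induction x generalizing y with
  | nil =>
    rcases y with _ | ⟨_ | _, y⟩
    · exact Or.inl rfl
    · refine Or.inr (Or.inr (Or.inr ⟨-(U * word y), (signDef_U.mul (signDef_word y)).neg, Or.inr ?_⟩))
      have : b * Low = -U := by decide
      simp [letter, ← mul_assoc, this]
    · exact Or.inr (Or.inl ⟨y, rfl⟩)
  | cons e x ih =>
    have hb : ∀ M : SL2Z, b * M⁻¹ = -(Low * tr M * ω) := by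
      intro M
      have : b = -(Low * ω) := by decide
      rw [this, tr]; simp [mul_assoc]
    rcases y with _ | ⟨f, y⟩
    · cases e
      · exact Or.inr (Or.inr (Or.inl ⟨x, rfl⟩))
      · refine Or.inr (Or.inr (Or.inr ⟨-(tr (word x) * U), ((signDef_word x).tr.mul signDef_U).neg,
          Or.inl ?_⟩))
        have : ω * (U⁻¹ * Low) = U := by decide
        rw [word_cons, mul_inv_rev, ← mul_assoc, hb]
        simp [letter, mul_assoc, this]
    · by_cases hef : e = f
      · subst hef
        have : (word (e :: x))⁻¹ * word (e :: y) = (word x)⁻¹ * word y := by simp [mul_assoc]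
        rw [mul_assoc b, this, ← mul_assoc b]
        rcases ih y with rfl | ⟨z, rfl⟩ | ⟨z, rfl⟩ | h
        · exact Or.inl rfl
        · exact Or.inr (Or.inl ⟨z, rfl⟩)
        · exact Or.inr (Or.inr (Or.inl ⟨z, rfl⟩))
        · exact Or.inr (Or.inr (Or.inr h))
      · have h₁ : ω * (U⁻¹ * Low) = U := by decide
        have h₂ : ω * (Low⁻¹ * U) = -Low := by decide
        have h : ∃ N : SL2Z, SignDef N ∧ ω * ((letter e)⁻¹ * letter f) = N := by
          cases e <;> cases f
          · exact absurd rfl hef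
          · exact ⟨-Low, signDef_Low.neg, h₂⟩
          · exact ⟨U, signDef_U, h₁⟩
          · exact absurd rfl hef
        obtain ⟨N, hN, h⟩ := h
        refine Or.inr (Or.inr (Or.inr ⟨-(tr (word x) * N * word y * Low),
          ((((signDef_word x).tr.mul hN).mul (signDef_word y)).mul signDef_Low).neg, Or.inl ?_⟩))
        rw [word_cons, mul_inv_rev, ← mul_assoc, hb, ← h]
        simp [mul_assoc]

/-- A pair is reduced, or one of its entries can be shortened by a Hurwitz move, or it is one of
the three pairs of short elements with product `UV`. -/
lemma reduced_or (r r' : Rep) :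
    Reduced r r' ∨
    (∃ s : Rep, s.len < r'.len ∧ s.elt = r.elt * r'.elt * r.elt⁻¹) ∨
    (∃ s : Rep, s.len < r.len ∧ s.elt = r'.elt⁻¹ * r.elt * r'.elt) ∨
    ∃ i, r = short i ∧ r' = short (i + 1) := by
  have hU : b ^ 2 * ω = -U := by decide
  have hU' : b * (b * ω) = -U := by decide
  rcases r with i | ⟨i, x⟩ <;> rcases r' with j | ⟨j, y⟩
  · have hJ : ∀ d, junction (short i) (short (i + d)) = b * b ^ (d : ℕ) * b * ω := fun d => by
      simp only [junction, mat, mul_assoc]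
      simp only [← mul_assoc _⁻¹, b_pow_inv_mul]
    rcases eq_add i j with rfl | rfl | rfl
    · refine Or.inl ⟨?_, fun _ => by simp⟩
      rw [hJ]
      simp only [Fin.val_zero, pow_zero, mul_one, mul_assoc, hU']
      exact signDef_U.neg
    · exact Or.inr (Or.inr (Or.inr ⟨i, rfl, rfl⟩))
    · refine Or.inl (reduced_of_eq_low_mul signDef_one (Or.inl ?_))
      rw [hJ]; decide
  · have hJ : ∀ d, junction (short i) (long (i + d) y) = b * (b ^ (d : ℕ) * ω) * word y * Low :=
      fun d => by
        rw [junction, mul_assoc _ (mat _), mul_assoc _ (_ * b), mat_long_mul]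
        simp only [mat, mul_assoc]
        simp only [← mul_assoc _⁻¹, b_pow_inv_mul]
    rcases eq_add i j with rfl | rfl | rfl
    · refine Or.inl (reduced_of_eq_mul_low (signDef_Low.mul (signDef_word y)) (Or.inl ?_))
      rw [hJ]; simp [b_mul_ω]
    · refine Or.inl (reduced_of_eq_mul_low (signDef_U.mul (signDef_word y)) (Or.inr ?_))
      rw [hJ]; simp [hU']
    · obtain ⟨s, hs, hs'⟩ := exists_conj_word y (short 0)
      obtain ⟨t, ht, ht'⟩ := exists_conj_b_pow (i + 1) s
      refine Or.inr (Or.inl ⟨t, by simp [len] at hs ht ⊢; omega, ?_⟩)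
      have hC : C * (b ^ 2 * ω) = b := by decide
      have h0 : (short 0).elt = C := by decide
      have hb : ∀ i : Fin 3, b ^ ((i + 2 : Fin 3) : ℕ) = b ^ (i : ℕ) * b ^ 2 := by decide
      rw [ht', hs', h0, pow_succ, show b ^ (i : ℕ) * b = b ^ (i : ℕ) * (C * (b ^ 2 * ω)) by rw [hC]]
      simp only [elt, mat, hb]
      group
  · have hJ : ∀ d, junction (long i x) (short (i + d)) =
        -(Low * tr (word x)) * (b ^ (d : ℕ) * b * ω) := fun d => by
      rw [junction, b_mul_inv_mat_long]
      simp only [mat, mul_assoc]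
      simp only [← mul_assoc _⁻¹, b_pow_inv_mul]
    rcases eq_add i j with rfl | rfl | rfl
    · refine Or.inl (reduced_of_eq_low_mul ((signDef_word x).tr.mul signDef_Low) (Or.inr ?_))
      rw [hJ]; simp [b_mul_ω, mul_assoc]
    · refine Or.inl (reduced_of_eq_low_mul ((signDef_word x).tr.mul signDef_U) (Or.inl ?_))
      rw [hJ]; simp [hU', mul_assoc]
    · obtain ⟨s, hs, hs'⟩ := exists_conj_word x (short 0)
      obtain ⟨t, ht, ht'⟩ := exists_conj_b_pow (i + 1) s
      refine Or.inr (Or.inr (Or.inl ⟨t, by simp [len] at hs ht ⊢; omega, ?_⟩))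
      have hC : b ^ 2 = -(C⁻¹ * (b * ω)) := by decide
      have h0 : (short 0).elt = C := by decide
      have hb : ∀ i : Fin 3, b ^ (i : ℕ) = b ^ ((i + 2 : Fin 3) : ℕ) * b := by decide
      have hb' : b ^ ((i : ℕ) + 1) = -(b ^ ((i + 2 : Fin 3) : ℕ) * (C⁻¹ * (b * ω))) := by
        rw [pow_succ, hb, mul_assoc, ← pow_two, hC, mul_neg]
      rw [ht', hs', h0, hb']
      simp only [elt, mat, inv_neg, neg_mul, mul_neg, neg_neg]
      rw [hb i]
      group
  · have hJ : ∀ d, junction (long i x) (long (i + d) y) =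
        -(Low * tr (word x)) * (b ^ (d : ℕ) * ω) * word y * Low := fun d => by
      rw [junction, mul_assoc _ (mat _), mul_assoc _ (_ * b), mat_long_mul, b_mul_inv_mat_long]
      simp only [mul_assoc]
      simp only [← mul_assoc _⁻¹, b_pow_inv_mul]
    rcases eq_add i j with rfl | rfl | rfl
    · have hJ0 : junction (long i x) (long (i + 0) y) = b * (word x)⁻¹ * word y * Low := by
        rw [junction, mul_assoc _ (mat _), mul_assoc _ (_ * b), mat_long_mul, mat, add_zero]
        group
      rcases compare_words x y with rfl | ⟨z, rfl⟩ | ⟨z, rfl⟩ | ⟨M, hM, h⟩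
      · refine Or.inl ⟨?_, fun _ => by simp⟩
        have : b * Low = -U := by decide
        rw [hJ0]
        simpa [this] using signDef_U.neg
      · obtain ⟨s₁, h₁, h₁'⟩ := exists_conj_word z (short 0)
        obtain ⟨s₂, h₂, h₂'⟩ := exists_conj_b_pow 1 s₁
        obtain ⟨s₃, h₃, h₃'⟩ := exists_conj_word x s₂
        obtain ⟨s₄, h₄, h₄'⟩ := exists_conj_ω s₃
        obtain ⟨s₅, h₅, h₅'⟩ := exists_conj_b_pow i s₄
        refine Or.inr (Or.inl ⟨s₅, by simp [len] at *; omega, ?_⟩)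
        have hC : C * U = -b := by decide
        have h0 : (short 0).elt = C := by decide
        have hb : ∀ M : SL2Z, b * M * b⁻¹ = C * U * M * (C * U)⁻¹ := by simp [hC, inv_neg]
        rw [h₅', h₄', h₃', h₂', h₁', h0, pow_one, hb]
        simp only [elt, mat, add_zero, word_append, word_cons, letter]
        group
      · obtain ⟨s₁, h₁, h₁'⟩ := exists_conj_word z (short 0)
        obtain ⟨s₂, h₂, h₂'⟩ := exists_conj_b_pow 2 s₁
        obtain ⟨s₃, h₃, h₃'⟩ := exists_conj_word y s₂
        obtain ⟨s₄, h₄, h₄'⟩ := exists_conj_ω s₃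
        obtain ⟨s₅, h₅, h₅'⟩ := exists_conj_b_pow i s₄
        refine Or.inr (Or.inr (Or.inl ⟨s₅, by simp [len] at *; omega, ?_⟩))
        have hC : b ^ 2 = -(C⁻¹ * Low) := by decide
        have hb : ∀ M : SL2Z, b ^ 2 * M * (b ^ 2)⁻¹ = C⁻¹ * Low * M * (C⁻¹ * Low)⁻¹ := by
          simp [hC, inv_neg]
        have h0 : (short 0).elt = C := by decide
        rw [h₅', h₄', h₃', h₂', h₁', h0, hb]
        simp only [elt, mat, add_zero, word_append, word_cons, letter]
        group
      · rw [← hJ0] at h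
        rcases h with h | h
        · exact Or.inl (reduced_of_eq_low_mul hM (Or.inl h))
        · exact Or.inl (reduced_of_eq_mul_low hM (Or.inl h))
    · refine Or.inl (reduced_of_eq_low_mul
        ((((signDef_word x).tr.mul signDef_Low).mul (signDef_word y)).mul signDef_Low) (Or.inr ?_))
      rw [hJ]; simp [b_mul_ω, mul_assoc]
    · refine Or.inl (reduced_of_eq_low_mul
        ((((signDef_word x).tr.mul signDef_U).mul (signDef_word y)).mul signDef_Low) (Or.inl ?_))
      have : b ^ ((2 : Fin 3) : ℕ) * ω = -U := by decide
      rw [hJ, this]; simp [mul_assoc]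

lemma equiv_UV (i : Fin 3) : HurwitzEquiv [(short i).elt, (short (i + 1)).elt] [U, V] := by
  have h0 : (short 0).elt = C := by decide
  have h1 : (short 1).elt = U := by decide
  have h2 : (short 2).elt = V := by decide
  have hC : V⁻¹ * U * V = C := by decide
  have hV : U⁻¹ * C * U = V := by decide
  have e1 : HurwitzEquiv [C, U] [U, V] := by
    simpa only [hV] using HurwitzEquiv.swap_right C U
  have e2 : HurwitzEquiv [V, C] [C, U] := by
    have : C⁻¹ * V * C = U := by decide
    simpa only [this] using HurwitzEquiv.swap_right V C
  have three : ∀ i : Fin 3, i = 0 ∨ i = 1 ∨ i = 2 := by decide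
  rcases three i with rfl | rfl | rfl
  · rw [show (0 : Fin 3) + 1 = 1 from rfl, h0, h1]; exact e1
  · rw [show (1 : Fin 3) + 1 = 2 from rfl, h1, h2]; exact .refl _
  · rw [show (2 : Fin 3) + 1 = 0 from rfl, h2, h0]; exact e2.trans e1

lemma conj_UV (r : Rep) : [U, V].prod⁻¹ * r.elt * [U, V].prod = r.rot.rot.elt := by
  have h : [U, V].prod = -(b * b)⁻¹ := by decide
  rw [h, elt_rot, elt_rot]
  simp [inv_neg, mul_assoc]

/-- Every sequence of conjugates of `U` is Hurwitz equivalent to a number of pairs `(U, V)`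
followed by a reduced sequence. -/
lemma exists_isChain_reduced (rs : List Rep) :
    ∃ (k : ℕ) (rs' : List Rep),
      HurwitzEquiv (rs.map elt) ((List.replicate k [U, V]).flatten ++ rs'.map elt) ∧
      rs'.IsChain Reduced := by
  induction hN : (rs.map len).sum + rs.length using Nat.strong_induction_on generalizing rs with
  | _ N ih =>
  by_cases hc : rs.IsChain Reduced
  · exact ⟨0, rs, by simpa using HurwitzEquiv.refl _, hc⟩
  obtain ⟨r, r', p, t, rfl, hr⟩ : ∃ r r' p t, rs = p ++ r :: r' :: t ∧ ¬ Reduced r r' := by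
    simpa [List.isChain_iff_forall_rel_of_append_cons_cons] using hc
  simp only [List.map_append, List.map_cons, List.sum_append, List.sum_cons, List.length_append,
    List.length_cons] at hN
  rcases reduced_or r r' with h | ⟨s, hs, hs'⟩ | ⟨s, hs, hs'⟩ | ⟨i, rfl, rfl⟩
  · exact absurd h hr
  · obtain ⟨k, rs', h, h'⟩ := ih _ (by simp; omega) (p ++ s :: r :: t) rfl
    refine ⟨k, rs', HurwitzEquiv.trans ?_ h, h'⟩
    have := (HurwitzEquiv.swap_left r.elt r'.elt).append (p.map elt) (t.map elt)
    simpa [hs'] using this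
  · obtain ⟨k, rs', h, h'⟩ := ih _ (by simp; omega) (p ++ r' :: s :: t) rfl
    refine ⟨k, rs', HurwitzEquiv.trans ?_ h, h'⟩
    have := (HurwitzEquiv.swap_right r.elt r'.elt).append (p.map elt) (t.map elt)
    simpa [hs'] using this
  · have hrot : ((p.map fun r => r.rot.rot).map len).sum = (p.map len).sum := by
      simp [Function.comp_def, len_rot]
    obtain ⟨k, rs', h, h'⟩ := ih _ (by
      rw [List.map_append, List.sum_append, hrot]; simp; omega)
      ((p.map fun r => r.rot.rot) ++ t) rfl
    refine ⟨k + 1, rs', ?_, h'⟩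
    have h₁ := (equiv_UV i).append (p.map elt) (t.map elt)
    have h₂ := (HurwitzEquiv.append_comm_conj (p.map elt) [U, V]).append_right (t.map elt)
    have h₃ := h.append_left [U, V]
    have e : (p.map elt).map (fun x => [U, V].prod⁻¹ * x * [U, V].prod) =
        (p.map fun r => r.rot.rot).map elt := by
      simp only [List.map_map, Function.comp_def, conj_UV]
    rw [e] at h₂
    have h₄ := h₁.trans (h₂.trans (by simpa using h₃))
    simpa [List.replicate_succ] using h₄

lemma exists_prod_eq (r : Rep) (rs : List Rep) (h : (r :: rs).IsChain Reduced) :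
    ∃ (l : Rep) (Z : SL2Z), SignDef Z ∧
      (((r :: rs).map elt).prod = r.mat * (b * ω) * Z * (b * l.mat⁻¹) ∨
        ((r :: rs).map elt).prod = -(r.mat * (b * ω) * Z * (b * l.mat⁻¹))) ∧
      (Z 1 0 = 0 → ∀ s ∈ rs, s.elt = r.elt) := by
  have hC : C = -(b * ω * b) := by decide
  have helt : ∀ s : Rep, s.elt = -(s.mat * (b * ω) * (b * s.mat⁻¹)) := fun s => by
    simp [elt, hC, mul_assoc]
  induction rs generalizing r with
  | nil => exact ⟨r, 1, signDef_one, Or.inr (by simp [helt, mul_assoc]), by simp⟩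
  | cons s rs ih =>
    rw [List.isChain_cons_cons] at h
    obtain ⟨⟨h₁, h₁'⟩, h₂⟩ := h
    obtain ⟨l, Z, hZ, hprod, hzero⟩ := ih s h₂
    refine ⟨l, junction r s * Z, h₁.mul hZ, ?_, fun h0 => ?_⟩
    · rw [List.map_cons, List.prod_cons, helt r]
      rcases hprod with hprod | hprod
      · right; rw [hprod]; simp [junction, mul_assoc]
      · left; rw [hprod]; simp [junction, mul_assoc]
    · have hle := h₁.abs_le_mul hZ
      rw [h0, abs_zero] at hle
      have ha := abs_nonneg (junction r s 1 0)
      have hb := abs_nonneg (Z 1 0)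
      have e₁ := h₁' (abs_eq_zero.1 (by linarith))
      have e₂ := hzero (abs_eq_zero.1 (by linarith))
      intro q hq
      rcases List.mem_cons.1 hq with rfl | hq
      · exact e₁
      · rw [e₂ q hq, e₁]

lemma b_pow_cases (c : Fin 3) : b ^ (c : ℕ) = 1 ∨ b ^ (c : ℕ) = b ∨ b ^ (c : ℕ) = b ^ 2 := by
  revert c; decide

lemma abs_le_one_of_signDef (n : ℕ) (c d : Fin 3)
    (h : SignDef (b ^ (c : ℕ) * U ^ n * b ^ (d : ℕ))) :
    |(b ^ (c : ℕ) * U ^ n * b ^ (d : ℕ)) 1 0| ≤ 1 := by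
  rw [signDef_iff] at h
  rw [abs_le]
  rcases b_pow_cases c with hc | hc | hc <;> rcases b_pow_cases d with hd | hd | hd <;>
    rw [hc, hd] at h ⊢ <;>
    simp [mul_apply', b_apply, b_sq_apply, U_pow_apply, -Matrix.SpecialLinearGroup.coe_mul,
      -Matrix.SpecialLinearGroup.coe_pow] at h ⊢ <;> omega

lemma eq_zero_of_signDef (n : ℕ) (c d : Fin 3)
    (h : SignDef (ω⁻¹ * b ^ (c : ℕ) * U ^ n * b ^ (d : ℕ))) :
    (ω⁻¹ * b ^ (c : ℕ) * U ^ n * b ^ (d : ℕ)) 1 0 = 0 := by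
  have hω : ω⁻¹ = -ω := by decide
  rw [signDef_iff] at h
  rw [hω] at h ⊢
  rcases b_pow_cases c with hc | hc | hc <;> rcases b_pow_cases d with hd | hd | hd <;>
    rw [hc, hd] at h ⊢ <;>
    simp [mul_apply', b_apply, b_sq_apply, U_pow_apply, ω_apply,
      -Matrix.SpecialLinearGroup.coe_mul, -Matrix.SpecialLinearGroup.coe_pow] at h ⊢ <;> omega

lemma eq_zero_of_low_mul (n : ℕ) (c d : Fin 3) {Z : SL2Z} (hZ : SignDef Z)
    (h : Low * Z = b ^ (c : ℕ) * U ^ n * b ^ (d : ℕ)) : Z 1 0 = 0 := by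
  rw [signDef_iff] at hZ
  rw [ext_iff'] at h
  rcases b_pow_cases c with hc | hc | hc <;> rcases b_pow_cases d with hd | hd | hd <;>
    rw [hc, hd] at h <;>
    simp [mul_apply', b_apply, b_sq_apply, U_pow_apply, Low_apply,
      -Matrix.SpecialLinearGroup.coe_mul, -Matrix.SpecialLinearGroup.coe_pow] at h <;> omega

lemma exists_b_pow_inv_mul (i c : Fin 3) :
    ∃ d : Fin 3, (b ^ (i : ℕ))⁻¹ * b ^ (c : ℕ) = b ^ (d : ℕ) := by
  revert i c; decide

lemma exists_b_pow_mul_inv (j : Fin 3) : ∃ d : Fin 3, (b * (b ^ (j : ℕ))⁻¹)⁻¹ = b ^ (d : ℕ) := by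
  revert j; decide

/-- If a reduced product is a power of `U` up to a power of `b`, then it starts with a short
element and has no nontrivial junction. -/
lemma short_of_prod_eq (r l : Rep) {Z : SL2Z} (hZ : SignDef Z) (n : ℕ) (c : Fin 3)
    (h : r.mat * (b * ω) * Z * (b * l.mat⁻¹) = b ^ (c : ℕ) * U ^ n) :
    (∃ i, r = short i) ∧ Z 1 0 = 0 := by
  have hl : ∃ (W : SL2Z) (d : Fin 3), (W = 1 ∨ SignDef W ∧ 1 ≤ |W 1 0|) ∧
      b * l.mat⁻¹ = W * (b ^ (d : ℕ))⁻¹ := by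
    rcases l with j | ⟨j, y⟩
    · obtain ⟨d, hd⟩ := exists_b_pow_mul_inv j
      exact ⟨1, d, Or.inl rfl, by rw [← hd]; simp [mat]⟩
    · refine ⟨-(Low * tr (word y)), j, Or.inr ⟨(signDef_Low.mul (signDef_word y).tr).neg, ?_⟩,
        b_mul_inv_mat_long j y⟩
      rw [neg_apply', abs_neg]
      exact one_le_abs_low_mul (signDef_word y).tr
  obtain ⟨W, d, hW, hd⟩ := hl
  have hWs : SignDef W := hW.elim (fun h => h ▸ signDef_one) And.left
  have hLZ := one_le_abs_low_mul hZ
  rw [hd, b_mul_ω] at h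
  rcases r with i | ⟨i, x⟩
  · refine ⟨⟨i, rfl⟩, ?_⟩
    obtain ⟨c', hc'⟩ := exists_b_pow_inv_mul i c
    have h' : Low * Z * W = b ^ (c' : ℕ) * U ^ n * b ^ (d : ℕ) := by
      rw [← hc', mul_assoc _ (b ^ (c : ℕ)), ← h, mat]
      group
    rcases hW with rfl | ⟨-, hW⟩
    · exact eq_zero_of_low_mul n c' d hZ (by rw [← h', mul_one])
    · have h₁ := (signDef_Low.mul hZ).abs_le_mul hWs
      have h₂ := abs_le_one_of_signDef n c' d (h' ▸ (signDef_Low.mul hZ).mul hWs)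
      rw [← h'] at h₂
      linarith
  · exfalso
    obtain ⟨c', hc'⟩ := exists_b_pow_inv_mul i c
    have h' : word x * (Low * Z) * W = ω⁻¹ * b ^ (c' : ℕ) * U ^ n * b ^ (d : ℕ) := by
      rw [← hc', mul_assoc ω⁻¹, mul_assoc (b ^ (i : ℕ))⁻¹, ← h, mat]
      group
    have hs := (signDef_word x).mul (signDef_Low.mul hZ)
    have h₀ := (signDef_word x).abs_le_mul (signDef_Low.mul hZ)
    have h₁ := hs.abs_le_mul hWs
    have h₂ := eq_zero_of_signDef n c' d (h' ▸ hs.mul hWs)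
    rw [← h'] at h₂
    rw [h₂, abs_zero] at h₁
    have a₁ := abs_nonneg (word x 1 0)
    have a₂ := abs_nonneg (W 1 0)
    linarith

end Rep

lemma neg_b_pow_six : (-b) ^ 6 = 1 := by decide

lemma neg_b_pow_cases (k : ℕ) :
    (k % 6 = 0 ∧ (-b) ^ k = 1) ∨ (k % 6 = 1 ∧ (-b) ^ k = -b) ∨ (k % 6 = 2 ∧ (-b) ^ k = b ^ 2) ∨
    (k % 6 = 3 ∧ (-b) ^ k = -1) ∨ (k % 6 = 4 ∧ (-b) ^ k = b) ∨
    (k % 6 = 5 ∧ (-b) ^ k = -b ^ 2) := by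
  rw [pow_eq_pow_mod k neg_b_pow_six]
  have : k % 6 < 6 := Nat.mod_lt _ (by norm_num)
  interval_cases k % 6 <;> decide

lemma V_pow_apply (n : ℕ) :
    (V ^ n) 0 0 = 1 ∧ (V ^ n) 0 1 = 0 ∧ (V ^ n) 1 0 = -n ∧ (V ^ n) 1 1 = 1 := by
  have hV : V 0 0 = 1 ∧ V 0 1 = 0 ∧ V 1 0 = -1 ∧ V 1 1 = 1 := ⟨rfl, rfl, rfl, rfl⟩
  induction n with
  | zero => simp
  | succ n ih =>
    obtain ⟨h1, h2, h3, h4⟩ := ih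
    simp only [pow_succ, mul_apply', h1, h2, h3, h4, hV]
    refine ⟨?_, ?_, ?_, ?_⟩ <;> first | trivial | (push_cast; ring)

lemma C_pow_apply (n : ℕ) :
    (C ^ n) 0 0 = 1 - n ∧ (C ^ n) 0 1 = n ∧ (C ^ n) 1 0 = -n ∧ (C ^ n) 1 1 = 1 + n := by
  have hC : C 0 0 = 0 ∧ C 0 1 = 1 ∧ C 1 0 = -1 ∧ C 1 1 = 2 := ⟨rfl, rfl, rfl, rfl⟩
  induction n with
  | zero => simp
  | succ n ih =>
    obtain ⟨h1, h2, h3, h4⟩ := ih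
    simp only [pow_succ, mul_apply', h1, h2, h3, h4, hC]
    push_cast
    refine ⟨?_, ?_, ?_, ?_⟩ <;> ring

lemma eq_of_mul_pow_eq {k m n : ℕ} {g : SL2Z} (hg : g = C ∨ g = U ∨ g = V)
    (h : (-b) ^ k * g ^ m = -(U ^ n)) : k % 6 = 3 ∧ m = n ∧ (m = 0 ∨ g = U) := by
  rw [ext_iff'] at h
  rcases hg with rfl | rfl | rfl <;>
    rcases neg_b_pow_cases k with ⟨hk, h'⟩ | ⟨hk, h'⟩ | ⟨hk, h'⟩ | ⟨hk, h'⟩ | ⟨hk, h'⟩ | ⟨hk, h'⟩ <;>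
    rw [h'] at h <;>
    simp [mul_apply', b_apply, b_sq_apply, U_pow_apply, V_pow_apply, C_pow_apply,
      -Matrix.SpecialLinearGroup.coe_mul, -Matrix.SpecialLinearGroup.coe_pow] at h <;>
    first
      | omega
      | exact ⟨hk, by omega, Or.inl (by omega)⟩
      | exact ⟨hk, by omega, Or.inr rfl⟩

/-- The alternation of the two braids `UVU` and `VUV`. -/
lemma equiv_UVU : HurwitzEquiv [U, V, U] [V, U, V] := by
  have h₁ : V⁻¹ * U * V = C := by decide
  have h₂ : U⁻¹ * C * U = V := by decide
  have e₁ := (HurwitzEquiv.swap_right U V).append_right [U]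
  have e₂ := (HurwitzEquiv.swap_right C U).append_left [V]
  rw [h₁] at e₁
  rw [h₂] at e₂
  exact e₁.trans e₂

lemma equiv_VUV : HurwitzEquiv [V, U, V] [U, V, U] := by
  have h₁ : U * V * U⁻¹ = C := by decide
  have h₂ : V * C * V⁻¹ = U := by decide
  have e₁ := (HurwitzEquiv.swap_left U V).append_left [V]
  have e₂ := (HurwitzEquiv.swap_left V C).append_right [U]
  rw [h₁] at e₁
  rw [h₂] at e₂
  exact e₁.trans e₂

lemma equiv_UV_three :
    HurwitzEquiv (List.replicate 3 [U, V]).flatten (List.replicate 3 [V, U]).flatten :=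
  (equiv_UVU.append_right [V, U, V]).trans (equiv_VUV.append_left [V, U, V])

lemma equiv_UV_pow (k : ℕ) :
    HurwitzEquiv (List.replicate (3 * k) [U, V]).flatten
      (List.replicate (3 * k) [V, U]).flatten := by
  induction k with
  | zero => exact .refl _
  | succ k ih =>
    have h := (ih.append_right (List.replicate 3 [U, V]).flatten).trans
      (equiv_UV_three.append_left (List.replicate (3 * k) [V, U]).flatten)
    rwa [← List.flatten_append, ← List.flatten_append, List.replicate_append_replicate,
      List.replicate_append_replicate] at h

lemma prod_UV (k : ℕ) : (List.replicate k [U, V]).flatten.prod = (-b) ^ k := by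
  induction k with
  | zero => rfl
  | succ k ih =>
    rw [List.replicate_succ, List.flatten_cons, List.prod_append, ih, pow_succ']
    simp [← UV_eq]

lemma prod_VU_central (k : ℕ) (g : SL2Z) :
    (List.replicate (3 * k) [V, U]).flatten.prod * g *
      (List.replicate (3 * k) [V, U]).flatten.prod⁻¹ = g := by
  rw [← (equiv_UV_pow k).prod_eq, prod_UV, pow_mul]
  have : (-b) ^ 3 = -1 := by decide
  rcases neg_one_pow_eq_or SL2Z k with h | h <;> rw [this, h] <;> simp [inv_neg]

end SL2Z

open SL2Z in
/-- **Strong normal factorization for type `Iₙ*`** : if `-Uⁿ = G₁⋯Gᵣ` with each `Gᵢ` a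
conjugate of `U` in `SL(2,ℤ)`, then `r = n + 6 + 12s` for some `s ≥ 0` and a finite sequence
of Hurwitz moves transforms `(G₁,…,Gᵣ)` into `n` copies of `U` followed by `6s + 3` copies of
the pair `(V, U)`, i.e. into the factorization `Uⁿ(VU)^(6s+3)`. -/
theorem strong_normal_factorization_Instar (n : ℕ) (L : List SL2Z)
    (hconj : ∀ A ∈ L, IsConj U A)
    (hprod : L.prod = -(U ^ n)) :
    ∃ s : ℕ, L.length = n + 6 + 12 * s ∧
      HurwitzEquiv L (List.replicate n U ++ (List.replicate (6 * s + 3) [V, U]).flatten) := by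
  obtain ⟨rs₀, rfl⟩ : ∃ rs : List Rep, rs.map Rep.elt = L := by
    clear hprod
    induction L with
    | nil => exact ⟨[], rfl⟩
    | cons A L ih =>
      obtain ⟨rs, hrs⟩ := ih fun B hB => hconj B (List.mem_cons_of_mem _ hB)
      obtain ⟨r, hr⟩ := Rep.exists_of_isConj (hconj A List.mem_cons_self)
      exact ⟨r :: rs, by rw [List.map_cons, hr, hrs]⟩
  obtain ⟨k, rs, hequiv, hred⟩ := Rep.exists_isChain_reduced rs₀
  have hp : (-b) ^ k * (rs.map Rep.elt).prod = -(U ^ n) := by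
    rw [← hprod, hequiv.prod_eq, List.prod_append, prod_UV]
  obtain ⟨m, g, hg, hrs⟩ : ∃ (m : ℕ) (g : SL2Z), (g = C ∨ g = U ∨ g = V) ∧
      rs.map Rep.elt = List.replicate m g := by
    rcases rs with _ | ⟨r, rs⟩
    · exact ⟨0, U, by simp, rfl⟩
    · obtain ⟨l, Z, hZ, hprodZ, hzero⟩ := Rep.exists_prod_eq r rs hred
      have hb : ∀ k : ℕ, ∃ c : Fin 3, -((-b) ^ k)⁻¹ = b ^ (c : ℕ) ∨ -((-b) ^ k)⁻¹ = -b ^ (c : ℕ) := by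
        intro k
        rw [pow_eq_pow_mod k neg_b_pow_six]
        have : k % 6 < 6 := Nat.mod_lt _ (by norm_num)
        interval_cases k % 6 <;> decide
      obtain ⟨c, hc⟩ := hb k
      have hp' : ((r :: rs).map Rep.elt).prod = -((-b) ^ k)⁻¹ * U ^ n := by
        rw [eq_comm, neg_mul, ← mul_neg, ← hp, inv_mul_cancel_left]
      have hshort : (∃ i, r = Rep.short i) ∧ Z 1 0 = 0 := by
        have key : r.mat * (b * ω) * Z * (b * l.mat⁻¹) = b ^ (c : ℕ) * U ^ n ∨
            r.mat * (b * ω) * (-Z) * (b * l.mat⁻¹) = b ^ (c : ℕ) * U ^ n := by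
          rcases hprodZ with h | h <;> rcases hc with hc | hc <;> rw [hp', hc] at h
          · exact Or.inl h.symm
          · exact Or.inr (by rw [mul_neg, neg_mul, ← h, neg_mul, neg_neg])
          · exact Or.inr (by rw [mul_neg, neg_mul, ← h])
          · exact Or.inl (by rw [neg_mul] at h; exact (neg_injective h).symm)
        rcases key with h | h
        · exact Rep.short_of_prod_eq r l hZ n c h
        · have := Rep.short_of_prod_eq r l hZ.neg n c h
          rwa [neg_apply', neg_eq_zero] at this
      obtain ⟨⟨i, rfl⟩, hZ0⟩ := hshort
      refine ⟨rs.length + 1, (Rep.short i).elt, ?_, ?_⟩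
      · exact (by decide : ∀ i, (Rep.short i).elt = C ∨ (Rep.short i).elt = U ∨
          (Rep.short i).elt = V) i
      · rw [List.eq_replicate_iff]
        refine ⟨by simp, fun x hx => ?_⟩
        rw [List.map_cons, List.mem_cons, List.mem_map] at hx
        rcases hx with rfl | ⟨s, hs, rfl⟩
        · rfl
        · exact hzero hZ0 s hs
  rw [hrs, List.prod_replicate] at hp
  obtain ⟨hk, rfl, hm⟩ := eq_of_mul_pow_eq hg hp
  have hgU : List.replicate m g = List.replicate m U := by
    rcases hm with rfl | rfl <;> rfl
  rw [hrs, hgU] at hequiv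
  obtain ⟨s, rfl⟩ : ∃ s, k = 6 * s + 3 := ⟨k / 6, by omega⟩
  refine ⟨s, ?_, hequiv.trans ?_⟩
  · rw [hequiv.length_eq]
    simp
    omega
  · have h₁ := (equiv_UV_pow (2 * s + 1)).append_right (List.replicate m U)
    have h₂ := HurwitzEquiv.append_comm_conj' (List.replicate (3 * (2 * s + 1)) [V, U]).flatten
      (List.replicate m U)
    simp only [prod_VU_central, List.map_id'] at h₂
    rw [show 6 * s + 3 = 3 * (2 * s + 1) by ring]
    exact h₁.trans h₂
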